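/- Suppose X_{T^c}ᵀX_{T^c} is invertible, where X_T ∈ ℝ^{t×p} and X_{T^c} ∈ ℝ^{(n−t)×p} are the row submatrices of X ∈ ℝ^{n×p} indexed by T and T^c. Then λ_min(P_{X,TT}^⊥) ≥ 1 − λ_max(X_TᵀX_T)/(λ_max(X_TᵀX_T) + λ_min(X_{T^c}ᵀX_{T^c})) > 0; in particular, the minimum eigenvalue condition holds. -/

import Mathlib

open Matrix MeasureTheory ProbabilityTheory
open scoped BigOperators ENNReal

noncomputable section

namespace Debug

variable {ι κ : Type*} [Fintype ι] [Fintype κ]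

/-- Squared Euclidean norm of a vector. -/
def sqNorm (v : ι → ℝ) : ℝ := ∑ i, v i ^ 2

/-- ℓ¹ norm of a vector. -/
def norm1 (v : ι → ℝ) : ℝ := ∑ i, |v i|

/-- ℓ∞ norm of a vector. -/
def normInf (v : ι → ℝ) : ℝ := ⨆ i, |v i|

/-- ℓ∞ operator norm of a matrix (maximum row ℓ¹ norm). -/
def matNormInf (M : Matrix ι κ ℝ) : ℝ := ⨆ i, ∑ j, |M i j|

/-- Elementwise max norm of a matrix. -/
def matNormMax (M : Matrix ι κ ℝ) : ℝ := ⨆ i, ⨆ j, |M i j|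

/-- Spectral norm of a matrix. -/
def specNorm (M : Matrix ι κ ℝ) : ℝ :=
  ⨆ v : {v : κ → ℝ // sqNorm v ≤ 1}, Real.sqrt (sqNorm (M.mulVec v.1))

/-- Minimum eigenvalue of a symmetric matrix, as the minimum Rayleigh quotient. -/
def minEig (M : Matrix ι ι ℝ) : ℝ :=
  ⨅ v : {v : ι → ℝ // sqNorm v = 1}, v.1 ⬝ᵥ M.mulVec v.1

/-- Maximum eigenvalue of a symmetric matrix, as the maximum Rayleigh quotient. -/
def maxEig (M : Matrix ι ι ℝ) : ℝ :=
  ⨆ v : {v : ι → ℝ // sqNorm v = 1}, v.1 ⬝ᵥ M.mulVec v.1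

variable [DecidableEq ι] [DecidableEq κ]

/-- Projection onto the column space of `A`. -/
def proj (A : Matrix ι κ ℝ) : Matrix ι ι ℝ := A * (Aᵀ * A)⁻¹ * Aᵀ

/-- Projection onto the orthogonal complement of the column space of `A`. -/
def projPerp (A : Matrix ι κ ℝ) : Matrix ι ι ℝ := 1 - proj A

variable {n m p : ℕ}

/-- The stacked design matrix `X' = [X; √(ηn/m)·X̃]`. -/
def stackM (η : ℝ) (X : Matrix (Fin n) (Fin p) ℝ) (Xt : Matrix (Fin m) (Fin p) ℝ) :
    Matrix (Fin n ⊕ Fin m) (Fin p) ℝ :=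
  Matrix.fromRows X (Real.sqrt (η * n / m) • Xt)

/-- The stacked vector `[v; √(ηn/m)·vt]` (with `n, m` the two pool sizes). -/
def stackV (η : ℝ) (n m : ℕ) (v : Fin n → ℝ) (vt : Fin m → ℝ) : Fin n ⊕ Fin m → ℝ :=
  Sum.elim v fun i => Real.sqrt (η * n / m) * vt i

/-- `P̄`: the submatrix of `P_{X'}^⊥` obtained by deleting the last `m` columns. -/
def Pbar (η : ℝ) (X : Matrix (Fin n) (Fin p) ℝ) (Xt : Matrix (Fin m) (Fin p) ℝ) :
    Matrix (Fin n ⊕ Fin m) (Fin n) ℝ :=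
  (projPerp (stackM η X Xt)).submatrix id Sum.inl

/-- The two-pool Lasso objective `γ ↦ (1/(2n))‖P_{X'}^⊥ y' − P̄γ‖₂² + λ‖γ‖₁`. -/
def lassoObj2 (η lam : ℝ) (X : Matrix (Fin n) (Fin p) ℝ) (Xt : Matrix (Fin m) (Fin p) ℝ)
    (y : Fin n → ℝ) (yt : Fin m → ℝ) (γ : Fin n → ℝ) : ℝ :=
  (1 / (2 * (n : ℝ))) *
      sqNorm ((projPerp (stackM η X Xt)).mulVec (stackV η n m y yt) - (Pbar η X Xt).mulVec γ)
    + lam * norm1 γ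

/-- The one-pool Lasso objective `γ ↦ (1/(2n))‖P_X^⊥ y − P_X^⊥ γ‖₂² + λ‖γ‖₁`. -/
def lassoObj1 (lam : ℝ) (X : Matrix (Fin n) (Fin p) ℝ) (y : Fin n → ℝ) (γ : Fin n → ℝ) : ℝ :=
  (1 / (2 * (n : ℝ))) * sqNorm ((projPerp X).mulVec y - (projPerp X).mulVec γ) + lam * norm1 γ

/-- The `T × T` block of `P_{X'}^⊥`. -/
def blockTT (η : ℝ) (X : Matrix (Fin n) (Fin p) ℝ) (Xt : Matrix (Fin m) (Fin p) ℝ)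
    (T : Finset (Fin n)) : Matrix ↥T ↥T ℝ :=
  (projPerp (stackM η X Xt)).submatrix (fun i => Sum.inl i.1) (fun j => Sum.inl j.1)

/-- The `T^c × T` block of `P_{X'}^⊥`. -/
def blockTcT (η : ℝ) (X : Matrix (Fin n) (Fin p) ℝ) (Xt : Matrix (Fin m) (Fin p) ℝ)
    (T : Finset (Fin n)) : Matrix {i : Fin n // i ∉ T} ↥T ℝ :=
  (projPerp (stackM η X Xt)).submatrix (fun i => Sum.inl i.1) (fun j => Sum.inl j.1)

/-- The `T × ·` block (rows indexed by `T`) of `P_{X'}^⊥`. -/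
def blockTdot (η : ℝ) (X : Matrix (Fin n) (Fin p) ℝ) (Xt : Matrix (Fin m) (Fin p) ℝ)
    (T : Finset (Fin n)) : Matrix ↥T (Fin n ⊕ Fin m) ℝ :=
  (projPerp (stackM η X Xt)).submatrix (fun i => Sum.inl i.1) id

/-- Columns of `P̄` indexed by `T`. -/
def PbarT (η : ℝ) (X : Matrix (Fin n) (Fin p) ℝ) (Xt : Matrix (Fin m) (Fin p) ℝ)
    (T : Finset (Fin n)) : Matrix (Fin n ⊕ Fin m) ↥T ℝ :=
  (Pbar η X Xt).submatrix id (fun j => j.1)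

/-- Columns of `P̄` indexed by `T^c`. -/
def PbarTc (η : ℝ) (X : Matrix (Fin n) (Fin p) ℝ) (Xt : Matrix (Fin m) (Fin p) ℝ)
    (T : Finset (Fin n)) : Matrix (Fin n ⊕ Fin m) {i : Fin n // i ∉ T} ℝ :=
  (Pbar η X Xt).submatrix id (fun j => j.1)

/-- `G'(λ)` from the support recovery theorems. -/
def Gprime (η lam : ℝ) (X : Matrix (Fin n) (Fin p) ℝ) (Xt : Matrix (Fin m) (Fin p) ℝ)
    (T : Finset (Fin n)) (εp : Fin n ⊕ Fin m → ℝ) : ℝ :=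
  normInf ((blockTT η X Xt T)⁻¹.mulVec ((blockTdot η X Xt T).mulVec εp))
    + (n : ℝ) * lam * matNormInf (blockTT η X Xt T)⁻¹

/-- The lower bound on the regularization parameter in the support recovery theorems. -/
def lamLB (η : ℝ) (X : Matrix (Fin n) (Fin p) ℝ) (Xt : Matrix (Fin m) (Fin p) ℝ)
    (T : Finset (Fin n)) (αp : ℝ) (εp : Fin n ⊕ Fin m → ℝ) : ℝ :=
  (2 / (1 - αp)) * normInf ((PbarTc η X Xt T)ᵀ.mulVec
    ((1 - PbarT η X Xt T * ((PbarT η X Xt T)ᵀ * PbarT η X Xt T)⁻¹ * (PbarT η X Xt T)ᵀ).mulVec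
      ((n : ℝ)⁻¹ • εp)))

/-- One-pool `T × T` block of `P_X^⊥`. -/
def blockTT1 (X : Matrix (Fin n) (Fin p) ℝ) (T : Finset (Fin n)) : Matrix ↥T ↥T ℝ :=
  (projPerp X).submatrix (fun i => i.1) (fun j => j.1)

/-- One-pool `T^c × T` block of `P_X^⊥`. -/
def blockTcT1 (X : Matrix (Fin n) (Fin p) ℝ) (T : Finset (Fin n)) :
    Matrix {i : Fin n // i ∉ T} ↥T ℝ :=
  (projPerp X).submatrix (fun i => i.1) (fun j => j.1)

/-- One-pool `T × ·` block of `P_X^⊥`. -/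
def blockTdot1 (X : Matrix (Fin n) (Fin p) ℝ) (T : Finset (Fin n)) : Matrix ↥T (Fin n) ℝ :=
  (projPerp X).submatrix (fun i => i.1) id

/-- A real random variable `Z` is (mean-zero) sub-Gaussian with variance parameter `σ2`. -/
def IsSubG {Ω : Type*} [MeasurableSpace Ω] (μ : Measure Ω) (Z : Ω → ℝ) (σ2 : ℝ) : Prop :=
  ∀ s : ℝ, ∫ ω, Real.exp (s * Z ω) ∂μ ≤ Real.exp (σ2 * s ^ 2 / 2)

/-- A random vector `Z` is sub-Gaussian with parameter `σ2`. -/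
def IsSubGVec {Ω : Type*} [MeasurableSpace Ω] (μ : Measure Ω) {p : ℕ}
    (Z : Ω → Fin p → ℝ) (σ2 : ℝ) : Prop :=
  ∀ u : Fin p → ℝ, sqNorm u = 1 → IsSubG μ (fun ω => ∑ j, u j * Z ω j) σ2

end Debug

namespace Debug

section RayleighQuotient

variable {α : Type*} [Fintype α]

lemma sqNorm_eq_dotProduct (v : α → ℝ) : sqNorm v = v ⬝ᵥ v := by
  simp [sqNorm, dotProduct, sq]

lemma sqNorm_pos {v : α → ℝ} (hv : v ≠ 0) : 0 < sqNorm v := by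
  obtain ⟨i, hi⟩ := Function.ne_iff.mp hv
  exact Finset.sum_pos' (fun _ _ => sq_nonneg _) ⟨i, Finset.mem_univ i, sq_pos_of_ne_zero hi⟩

lemma isCompact_setOf_sqNorm_eq_one : IsCompact {v : α → ℝ | sqNorm v = 1} := by
  refine Metric.isCompact_of_isClosed_isBounded ?_ ?_
  · exact isClosed_eq (by unfold sqNorm; fun_prop) continuous_const
  · refine (Metric.isBounded_closedBall (x := (0 : α → ℝ)) (r := 1)).subset fun v hv => ?_
    rw [mem_closedBall_zero_iff, pi_norm_le_iff_of_nonneg zero_le_one]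
    intro i
    rw [Real.norm_eq_abs, ← sq_le_one_iff_abs_le_one, ← show sqNorm v = 1 from hv]
    exact Finset.single_le_sum (f := fun i => v i ^ 2) (fun _ _ => sq_nonneg _) (Finset.mem_univ i)

lemma continuous_dotProduct_mulVec_self (M : Matrix α α ℝ) :
    Continuous fun v : α → ℝ => v ⬝ᵥ M *ᵥ v := by
  unfold dotProduct mulVec dotProduct
  fun_prop

lemma bddBelow_range_rayleigh (M : Matrix α α ℝ) :
    BddBelow (Set.range fun v : {v : α → ℝ // sqNorm v = 1} => v.1 ⬝ᵥ M *ᵥ v.1) := by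
  refine (isCompact_setOf_sqNorm_eq_one.bddBelow_image
    (continuous_dotProduct_mulVec_self M).continuousOn).mono ?_
  rintro _ ⟨v, rfl⟩
  exact ⟨v.1, v.2, rfl⟩

lemma bddAbove_range_rayleigh (M : Matrix α α ℝ) :
    BddAbove (Set.range fun v : {v : α → ℝ // sqNorm v = 1} => v.1 ⬝ᵥ M *ᵥ v.1) := by
  refine (isCompact_setOf_sqNorm_eq_one.bddAbove_image
    (continuous_dotProduct_mulVec_self M).continuousOn).mono ?_
  rintro _ ⟨v, rfl⟩
  exact ⟨v.1, v.2, rfl⟩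

lemma exists_unit_rayleigh_mul (M : Matrix α α ℝ) {v : α → ℝ} (hv : v ≠ 0) :
    ∃ u : {u : α → ℝ // sqNorm u = 1}, v ⬝ᵥ M *ᵥ v = (u.1 ⬝ᵥ M *ᵥ u.1) * sqNorm v := by
  have h := sqNorm_pos hv
  have hr := Real.sq_sqrt h.le
  have hr0 : √(sqNorm v) ≠ 0 := (Real.sqrt_pos.2 h).ne'
  refine ⟨⟨(√(sqNorm v))⁻¹ • v, ?_⟩, ?_⟩
  · rw [sqNorm_eq_dotProduct, smul_dotProduct, dotProduct_smul, ← sqNorm_eq_dotProduct]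
    simp only [smul_eq_mul]
    field_simp
    exact hr.symm
  · simp only [mulVec_smul, smul_dotProduct, dotProduct_smul, smul_eq_mul]
    field_simp
    rw [hr]

lemma minEig_mul_sqNorm_le (M : Matrix α α ℝ) (v : α → ℝ) :
    minEig M * sqNorm v ≤ v ⬝ᵥ M *ᵥ v := by
  rcases eq_or_ne v 0 with rfl | hv
  · simp [sqNorm]
  obtain ⟨u, hu⟩ := exists_unit_rayleigh_mul M hv
  rw [hu]
  exact mul_le_mul_of_nonneg_right (ciInf_le (bddBelow_range_rayleigh M) u) (sqNorm_pos hv).le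

lemma le_maxEig_mul_sqNorm (M : Matrix α α ℝ) (v : α → ℝ) :
    v ⬝ᵥ M *ᵥ v ≤ maxEig M * sqNorm v := by
  rcases eq_or_ne v 0 with rfl | hv
  · simp [sqNorm]
  obtain ⟨u, hu⟩ := exists_unit_rayleigh_mul M hv
  rw [hu]
  exact mul_le_mul_of_nonneg_right (le_ciSup (bddAbove_range_rayleigh M) u) (sqNorm_pos hv).le

lemma nonempty_setOf_sqNorm_eq_one [Nonempty α] : {v : α → ℝ | sqNorm v = 1}.Nonempty := by
  classical
  obtain ⟨i⟩ := ‹Nonempty α›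
  exact ⟨Pi.single i 1, by simp [sqNorm_eq_dotProduct]⟩

lemma le_minEig [Nonempty α] {M : Matrix α α ℝ} {c : ℝ}
    (h : ∀ v, sqNorm v = 1 → c ≤ v ⬝ᵥ M *ᵥ v) : c ≤ minEig M :=
  haveI : Nonempty {v : α → ℝ // sqNorm v = 1} := nonempty_setOf_sqNorm_eq_one.to_subtype
  le_ciInf fun v => h v.1 v.2

lemma minEig_pos [Nonempty α] {M : Matrix α α ℝ} (h : ∀ v, v ≠ 0 → 0 < v ⬝ᵥ M *ᵥ v) :
    0 < minEig M := by
  obtain ⟨u, hu, hmin⟩ := isCompact_setOf_sqNorm_eq_one.exists_isMinOn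
    nonempty_setOf_sqNorm_eq_one (continuous_dotProduct_mulVec_self M).continuousOn
  have hu0 : u ≠ 0 := by
    rintro rfl
    simp [sqNorm] at hu
  exact (h u hu0).trans_le (le_minEig fun v hv => hmin hv)

end RayleighQuotient

section Gram

variable {α β γ : Type*} [Fintype α] [Fintype β] [Fintype γ]

lemma dotProduct_gram_mulVec (A : Matrix α γ ℝ) (v : γ → ℝ) :
    v ⬝ᵥ (Aᵀ * A) *ᵥ v = sqNorm (A *ᵥ v) := by
  rw [← mulVec_mulVec, dotProduct_mulVec, vecMul_transpose, sqNorm_eq_dotProduct]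

lemma sqNorm_nonneg (v : α → ℝ) : 0 ≤ sqNorm v :=
  Finset.sum_nonneg fun _ _ => sq_nonneg _

lemma maxEig_gram_nonneg (A : Matrix α γ ℝ) : 0 ≤ maxEig (Aᵀ * A) :=
  Real.iSup_nonneg fun v => by
    rw [dotProduct_gram_mulVec]
    exact sqNorm_nonneg _

variable [DecidableEq γ]

lemma sqNorm_mulVec_pos {B : Matrix β γ ℝ} (hB : IsUnit (Bᵀ * B).det) {v : γ → ℝ} (hv : v ≠ 0) :
    0 < sqNorm (B *ᵥ v) := by
  refine sqNorm_pos fun h => hv ?_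
  refine eq_zero_of_mulVec_eq_zero hB.ne_zero (M := Bᵀ * B) ?_
  rw [← mulVec_mulVec, h, mulVec_zero]

lemma minEig_gram_pos [Nonempty γ] {B : Matrix β γ ℝ} (hB : IsUnit (Bᵀ * B).det) :
    0 < minEig (Bᵀ * B) :=
  minEig_pos fun v hv => by
    rw [dotProduct_gram_mulVec]
    exact sqNorm_mulVec_pos hB hv

lemma isUnit_det_gram_add (A : Matrix α γ ℝ) {B : Matrix β γ ℝ} (hB : IsUnit (Bᵀ * B).det) :
    IsUnit (Aᵀ * A + Bᵀ * B).det := by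
  rw [isUnit_iff_ne_zero]
  intro h
  obtain ⟨v, hv, hv0⟩ := exists_mulVec_eq_zero_iff.mpr h
  have h1 : sqNorm (A *ᵥ v) + sqNorm (B *ᵥ v) = 0 := by
    rw [← dotProduct_gram_mulVec, ← dotProduct_gram_mulVec, ← dotProduct_add, ← add_mulVec, hv0,
      dotProduct_zero]
  linarith [sqNorm_nonneg (A *ᵥ v), sqNorm_mulVec_pos hB hv]

lemma one_sub_div_le_minEig [DecidableEq α] [Nonempty α] [Nonempty γ] (A : Matrix α γ ℝ) {B : Matrix β γ ℝ}
    (hB : IsUnit (Bᵀ * B).det) :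
    1 - maxEig (Aᵀ * A) / (maxEig (Aᵀ * A) + minEig (Bᵀ * B))
      ≤ minEig (1 - A * (Aᵀ * A + Bᵀ * B)⁻¹ * Aᵀ) := by
  refine le_minEig fun u hu => ?_
  set w := (Aᵀ * A + Bᵀ * B)⁻¹ *ᵥ (Aᵀ *ᵥ u) with hw
  have hGw : (Aᵀ * A + Bᵀ * B) *ᵥ w = Aᵀ *ᵥ u := by
    rw [hw, mulVec_mulVec, mul_nonsing_inv _ (isUnit_det_gram_add A hB), one_mulVec]
  have hs : u ⬝ᵥ A *ᵥ w = sqNorm (A *ᵥ w) + sqNorm (B *ᵥ w) := by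
    rw [← dotProduct_gram_mulVec, ← dotProduct_gram_mulVec, ← dotProduct_add, ← add_mulVec, hGw,
      dotProduct_mulVec, dotProduct_comm, mulVec_transpose]
  have hblock : u ⬝ᵥ (1 - A * (Aᵀ * A + Bᵀ * B)⁻¹ * Aᵀ) *ᵥ u = 1 - u ⬝ᵥ A *ᵥ w := by
    rw [sub_mulVec, one_mulVec, dotProduct_sub, ← sqNorm_eq_dotProduct, hu, hw, mulVec_mulVec,
      mulVec_mulVec, Matrix.mul_assoc]
  have hcs : (u ⬝ᵥ A *ᵥ w) ^ 2 ≤ sqNorm (A *ᵥ w) := by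
    have := Finset.sum_mul_sq_le_sq_mul_sq Finset.univ u (A *ᵥ w)
    rwa [← sqNorm, hu, one_mul] at this
  have hL := le_maxEig_mul_sqNorm (Aᵀ * A) w
  have hl := minEig_mul_sqNorm_le (Bᵀ * B) w
  rw [dotProduct_gram_mulVec] at hL hl
  have hL0 := maxEig_gram_nonneg A
  have hl0 := minEig_gram_pos hB
  have hb := sqNorm_nonneg (B *ᵥ w)
  rw [hblock]
  set s := u ⬝ᵥ A *ᵥ w
  set L := maxEig (Aᵀ * A)
  set l := minEig (Bᵀ * B)
  set a := sqNorm (A *ᵥ w)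
  set b := sqNorm (B *ᵥ w)
  have hab : l * a ≤ L * b := by
    nlinarith [mul_le_mul_of_nonneg_left hL hl0.le, mul_le_mul_of_nonneg_left hl hL0]
  have hquad : (L + l) * s * s ≤ L * s := by
    nlinarith [mul_le_mul_of_nonneg_left hcs (add_nonneg hL0 hl0.le)]
  gcongr
  rw [le_div_iff₀ (by positivity), mul_comm]
  rcases (show 0 ≤ s by linarith [sqNorm_nonneg (A *ᵥ w)]).eq_or_lt with h | h
  · rw [← h, mul_zero]
    exact hL0
  · exact le_of_mul_le_mul_right hquad h

end Gram

lemma transpose_mul_self_eq_add_submatrix {α γ : Type*} [Fintype α] [DecidableEq α]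
    (X : Matrix α γ ℝ) (T : Finset α) :
    Xᵀ * X = (X.submatrix (fun i : ↥T => i.1) id)ᵀ * X.submatrix (fun i : ↥T => i.1) id
      + (X.submatrix (fun i : {i // i ∉ T} => i.1) id)ᵀ
        * X.submatrix (fun i : {i // i ∉ T} => i.1) id := by
  ext j k
  simp only [Matrix.add_apply, mul_apply, transpose_apply, submatrix_apply, id]
  convert (Fintype.sum_subtype_add_sum_subtype (· ∈ T) fun i => X i j * X i k).symm

lemma blockTT1_eq {n p : ℕ} (X : Matrix (Fin n) (Fin p) ℝ) (T : Finset (Fin n)) :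
    blockTT1 X T = 1 - X.submatrix (fun i : ↥T => i.1) id * (Xᵀ * X)⁻¹
      * (X.submatrix (fun i : ↥T => i.1) id)ᵀ := by
  ext i j
  simp only [blockTT1, projPerp, proj, submatrix_apply, Matrix.sub_apply, one_apply, Subtype.ext_iff]
  rfl

/-- lower bound on the minimum eigenvalue of the `T×T` block of
`P_X^⊥` (Lemma eigenClaim). -/
theorem statement_11
    (n p t : ℕ) (ht : 0 < t) (hp : 0 < p)
    (X : Matrix (Fin n) (Fin p) ℝ)
    (T : Finset (Fin n)) (hcard : T.card = t)
    (XT : Matrix ↥T (Fin p) ℝ) (hXT : XT = X.submatrix (fun i : ↥T => i.1) id)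
    (XTc : Matrix {i : Fin n // i ∉ T} (Fin p) ℝ)
    (hXTc : XTc = X.submatrix (fun i : {i : Fin n // i ∉ T} => i.1) id)
    (hinv : IsUnit (XTcᵀ * XTc).det) :
    1 - maxEig (XTᵀ * XT) / (maxEig (XTᵀ * XT) + minEig (XTcᵀ * XTc))
        ≤ minEig (blockTT1 X T)
      ∧ 0 < 1 - maxEig (XTᵀ * XT) / (maxEig (XTᵀ * XT) + minEig (XTcᵀ * XTc))
      ∧ 0 < minEig (blockTT1 X T) := by
  have : Nonempty (Fin p) := ⟨⟨0, hp⟩⟩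
  have : Nonempty ↥T := (Finset.card_pos.mp (hcard ▸ ht)).to_subtype
  have hle : 1 - maxEig (XTᵀ * XT) / (maxEig (XTᵀ * XT) + minEig (XTcᵀ * XTc))
      ≤ minEig (blockTT1 X T) := by
    rw [blockTT1_eq, transpose_mul_self_eq_add_submatrix X T, ← hXT, ← hXTc]
    exact one_sub_div_le_minEig XT hinv
  have hpos : 0 < 1 - maxEig (XTᵀ * XT) / (maxEig (XTᵀ * XT) + minEig (XTcᵀ * XTc)) := by
    have hL := maxEig_gram_nonneg XT
    have hl := minEig_gram_pos hinv
    rw [sub_pos, div_lt_one (by positivity)]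
    linarith
  exact ⟨hle, hpos, hpos.trans_le hle⟩

end Debug
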